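/- Let a > 0, λ > 0 and c < 1. Then the function z ↦ Ψ(a, c−2λ, z) · Ψ(a+2λ, c, z) / (Ψ(a+λ, c−λ, z))² is strictly decreasing on (0,∞), and for every z > 0 one has the sharp bounds 1 < Ψ(a, c−2λ, z) Ψ(a+2λ, c, z) / (Ψ(a+λ, c−λ, z))² < Γ(1−c)Γ(1−c+2λ)/Γ(1−c+λ)². -/

import Mathlib

open MeasureTheory Set

/-- The confluent hypergeometric function of the second kind (Tricomi's integral). -/
noncomputable def Psi (a c z : ℝ) : ℝ :=
  (1 / Real.Gamma a) * ∫ t in Ioi (0 : ℝ), Real.exp (-z * t) * t ^ (a - 1) * (1 + t) ^ (c - a - 1)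

open Filter Topology

/-- The integrand of Tricomi's integral, parametrised by the decay exponent `b = a + 1 - c`. -/
noncomputable def tricomiKernel (a b z t : ℝ) : ℝ :=
  Real.exp (-z * t) * t ^ (a - 1) * (1 + t) ^ (-b)

/-- Tricomi's integral without the factor `1 / Γ(a)`. -/
noncomputable def tricomiIntegral (a b z : ℝ) : ℝ :=
  ∫ t in Ioi (0 : ℝ), tricomiKernel a b z t

lemma tricomiKernel_pos (a b z : ℝ) {t : ℝ} (ht : 0 < t) : 0 < tricomiKernel a b z t := by
  unfold tricomiKernel; positivity

lemma measurable_tricomiKernel (a b z : ℝ) : Measurable (tricomiKernel a b z) := by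
  unfold tricomiKernel; fun_prop

lemma tricomiKernel_le {a b z t : ℝ} (hb : 0 ≤ b) (ht : 0 < t) :
    tricomiKernel a b z t ≤ t ^ (a - 1) * Real.exp (-(z * t)) := by
  have h : (1 + t) ^ (-b) ≤ 1 := Real.rpow_le_one_of_one_le_of_nonpos (by linarith) (by linarith)
  have : tricomiKernel a b z t = t ^ (a - 1) * Real.exp (-(z * t)) * (1 + t) ^ (-b) := by
    unfold tricomiKernel; ring_nf
  rw [this]
  exact mul_le_of_le_one_right (by positivity) h

lemma le_tricomiKernel {a b z t : ℝ} (hb : 0 ≤ b) (ht : 0 < t) :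
    t ^ (a - 1) * Real.exp (-((z + b) * t)) ≤ tricomiKernel a b z t := by
  have h : Real.exp (-(b * t)) ≤ (1 + t) ^ (-b) := by
    rw [Real.rpow_def_of_pos (by linarith), Real.exp_le_exp]
    nlinarith [Real.log_le_sub_one_of_pos (by linarith : (0 : ℝ) < 1 + t)]
  have e : Real.exp (-((z + b) * t)) = Real.exp (-z * t) * Real.exp (-(b * t)) := by
    rw [← Real.exp_add]; ring_nf
  have : tricomiKernel a b z t = t ^ (a - 1) * (Real.exp (-z * t) * (1 + t) ^ (-b)) := by
    unfold tricomiKernel; ring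
  rw [this, e]
  gcongr

lemma integrableOn_rpow_mul_exp_neg_mul {a z : ℝ} (ha : 0 < a) (hz : 0 < z) :
    IntegrableOn (fun t : ℝ => t ^ (a - 1) * Real.exp (-(z * t))) (Ioi 0) := by
  simpa using integrableOn_rpow_mul_exp_neg_mul_rpow (p := 1) (s := a - 1) (b := z)
    (by linarith) one_pos hz

lemma integrableOn_tricomiKernel {a b z : ℝ} (ha : 0 < a) (hb : 0 ≤ b) (hz : 0 < z) :
    IntegrableOn (tricomiKernel a b z) (Ioi 0) := by
  refine (integrableOn_rpow_mul_exp_neg_mul ha hz).mono'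
    (measurable_tricomiKernel a b z).aestronglyMeasurable ?_
  filter_upwards [ae_restrict_mem measurableSet_Ioi] with t ht
  rw [Real.norm_of_nonneg (tricomiKernel_pos a b z ht).le]
  exact tricomiKernel_le hb ht

lemma setIntegral_Ioi_pos {f : ℝ → ℝ} (t₀ : ℝ) (hf : ∀ t, 0 < t → 0 ≤ f t)
    (hf' : ∀ t, 0 < t → t ≠ t₀ → f t ≠ 0) (hi : IntegrableOn f (Ioi 0)) :
    0 < ∫ t in Ioi (0 : ℝ), f t := by
  rw [setIntegral_pos_iff_support_of_nonneg_ae _ hi]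
  · calc (0 : ENNReal) < volume (Ioi (max 0 t₀)) := by simp
      _ ≤ _ := measure_mono fun t ht => by
        have ht := max_lt_iff.1 (mem_Ioi.1 ht)
        exact ⟨hf' t ht.1 ht.2.ne', ht.1⟩
  · filter_upwards [ae_restrict_mem measurableSet_Ioi] with t ht using hf t ht

lemma tricomiIntegral_pos {a b z : ℝ} (ha : 0 < a) (hb : 0 ≤ b) (hz : 0 < z) :
    0 < tricomiIntegral a b z :=
  setIntegral_Ioi_pos 0 (fun _ ht => (tricomiKernel_pos a b z ht).le)
    (fun _ ht _ => (tricomiKernel_pos a b z ht).ne') (integrableOn_tricomiKernel ha hb hz)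

lemma tricomiIntegral_le {a b z : ℝ} (ha : 0 < a) (hb : 0 ≤ b) (hz : 0 < z) :
    tricomiIntegral a b z ≤ (1 / z) ^ a * Real.Gamma a := by
  rw [← Real.integral_rpow_mul_exp_neg_mul_Ioi ha hz]
  exact setIntegral_mono_on (integrableOn_tricomiKernel ha hb hz)
    (integrableOn_rpow_mul_exp_neg_mul ha hz) measurableSet_Ioi fun t ht => tricomiKernel_le hb ht

lemma le_tricomiIntegral {a b z : ℝ} (ha : 0 < a) (hb : 0 ≤ b) (hz : 0 < z) :
    (1 / (z + b)) ^ a * Real.Gamma a ≤ tricomiIntegral a b z := by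
  have hzb : 0 < z + b := by linarith
  rw [← Real.integral_rpow_mul_exp_neg_mul_Ioi ha hzb]
  exact setIntegral_mono_on (integrableOn_rpow_mul_exp_neg_mul ha hzb)
    (integrableOn_tricomiKernel ha hb hz) measurableSet_Ioi fun t ht => le_tricomiKernel hb ht

lemma tricomiKernel_add_one (a b z : ℝ) {t : ℝ} (ht : 0 < t) :
    tricomiKernel (a + 1) b z t = t * tricomiKernel a b z t := by
  unfold tricomiKernel
  rw [show a + 1 - 1 = a - 1 + 1 by ring, Real.rpow_add_one ht.ne']; ring

lemma tricomiKernel_eq_one_add_mul (a b z : ℝ) {t : ℝ} (ht : 0 < t) :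
    tricomiKernel a b z t = (1 + t) * tricomiKernel a (b + 1) z t := by
  unfold tricomiKernel
  rw [show -b = -(b + 1) + 1 by ring, Real.rpow_add_one (by linarith)]; ring

lemma hasDerivAt_tricomiIntegral {a b z : ℝ} (ha : 0 < a) (hb : 0 ≤ b) (hz : 0 < z) :
    HasDerivAt (tricomiIntegral a b) (-tricomiIntegral (a + 1) b z) z := by
  have h := (hasDerivAt_integral_of_dominated_loc_of_deriv_le (μ := volume.restrict (Ioi (0 : ℝ)))
    (F := tricomiKernel a b) (F' := fun x t => -tricomiKernel (a + 1) b x t) (x₀ := z)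
    (s := Ioi (z / 2)) (bound := tricomiKernel (a + 1) b (z / 2)) (Ioi_mem_nhds (by linarith))
    (Eventually.of_forall fun x => (measurable_tricomiKernel a b x).aestronglyMeasurable)
    (integrableOn_tricomiKernel ha hb hz)
    (measurable_tricomiKernel (a + 1) b z).neg.aestronglyMeasurable
    ?_ (integrableOn_tricomiKernel (by linarith) hb (by linarith)) ?_).2
  · rwa [integral_neg] at h
  · filter_upwards [ae_restrict_mem measurableSet_Ioi] with t ht x hx
    rw [norm_neg, Real.norm_of_nonneg (tricomiKernel_pos _ b x ht).le]
    unfold tricomiKernel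
    have ht : 0 < t := ht
    have hx : z / 2 < x := hx
    gcongr
  · filter_upwards [ae_restrict_mem measurableSet_Ioi] with t ht x hx
    have : HasDerivAt (fun x : ℝ => Real.exp (-x * t)) (Real.exp (-x * t) * (-1 * t)) x :=
      ((hasDerivAt_neg x).mul_const t).exp
    rw [tricomiKernel_add_one a b x ht]
    refine ((this.mul_const (t ^ (a - 1))).mul_const ((1 + t) ^ (-b))).congr_deriv ?_
    unfold tricomiKernel; ring

lemma tricomiIntegral_add_tricomiIntegral {a b z : ℝ} (ha : 0 < a) (hb : 0 ≤ b) (hz : 0 < z) :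
    tricomiIntegral a (b + 1) z + tricomiIntegral (a + 1) (b + 1) z = tricomiIntegral a b z := by
  unfold tricomiIntegral
  rw [← integral_add (integrableOn_tricomiKernel ha (by linarith) hz)
    (integrableOn_tricomiKernel (by linarith) (by linarith) hz)]
  refine setIntegral_congr_fun measurableSet_Ioi fun t ht => ?_
  rw [tricomiKernel_eq_one_add_mul a b z ht, tricomiKernel_add_one a (b + 1) z ht]; ring

lemma mul_tricomiIntegral_add_one {a b z : ℝ} (ha : 0 < a) (hb : 0 ≤ b) (hz : 0 < z) :
    z * tricomiIntegral (a + 1) b z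
      = a * tricomiIntegral a b z - b * tricomiIntegral (a + 1) (b + 1) z := by
  have i₁ := integrableOn_tricomiKernel ha hb hz
  have i₂ := integrableOn_tricomiKernel (a := a + 1) (by linarith) hb hz
  have i₃ := integrableOn_tricomiKernel (a := a + 1) (b := b + 1) (by linarith) (by linarith) hz
  have i₁₃ : IntegrableOn (fun t => a * tricomiKernel a b z t
      - b * tricomiKernel (a + 1) (b + 1) z t) (Ioi 0) := (i₁.const_mul a).sub (i₃.const_mul b)
  have i : IntegrableOn (fun t => a * tricomiKernel a b z t
      - b * tricomiKernel (a + 1) (b + 1) z t - z * tricomiKernel (a + 1) b z t) (Ioi 0) :=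
    i₁₃.sub (i₂.const_mul z)
  have h₀ : tricomiKernel (a + 1) b z 0 = 0 := by
    simp [tricomiKernel, Real.zero_rpow ha.ne']
  have key := integral_Ioi_of_hasDerivAt_of_tendsto (f := tricomiKernel (a + 1) b z) (m := 0)
    ?_ ?_ i ?_
  · rw [h₀, integral_sub i₁₃ (i₂.const_mul z), integral_sub (i₁.const_mul a) (i₃.const_mul b)]
      at key
    simp only [integral_const_mul] at key
    unfold tricomiIntegral
    linarith
  · have h₁ : ContinuousAt (fun t : ℝ => t ^ (a + 1 - 1)) 0 :=
      Real.continuousAt_rpow_const _ _ (Or.inr (by linarith))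
    have h₂ : ContinuousAt (fun t : ℝ => (1 + t) ^ (-b)) 0 :=
      (by fun_prop : ContinuousAt (fun t : ℝ => 1 + t) 0).rpow_const (Or.inl (by norm_num))
    exact (((by fun_prop : ContinuousAt (fun t : ℝ => Real.exp (-z * t)) 0).mul h₁).mul
      h₂).continuousWithinAt
  · intro t ht
    have ht : 0 < t := ht
    have h₁ : HasDerivAt (fun t : ℝ => Real.exp (-z * t)) (Real.exp (-z * t) * (-z * 1)) t :=
      ((hasDerivAt_id t).const_mul (-z)).exp
    have h₂ := Real.hasDerivAt_rpow_const (x := t) (p := a + 1 - 1) (Or.inl ht.ne')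
    have h₃ := ((hasDerivAt_id t).const_add 1).rpow_const (p := -b)
      (Or.inl (by simp only [id]; linarith))
    refine ((h₁.mul h₂).mul h₃).congr_deriv ?_
    simp only [tricomiKernel, id, Pi.mul_apply]
    rw [show -(b + 1) = -b - 1 by ring, show a + 1 - 1 = a by ring]
    ring
  · refine squeeze_zero' (eventually_gt_atTop 0 |>.mono fun t ht => (tricomiKernel_pos _ b z ht).le)
      (eventually_gt_atTop 0 |>.mono fun t ht => tricomiKernel_le hb ht) ?_
    simpa using tendsto_rpow_mul_exp_neg_mul_atTop_nhds_zero (a + 1 - 1) z hz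

lemma mul_tricomiIntegral_add_two {a b z : ℝ} (ha : 0 < a) (hb : 0 ≤ b) (hz : 0 < z) :
    z * tricomiIntegral (a + 1 + 1) b z
      = a * tricomiIntegral a b z - (z + b - a - 1) * tricomiIntegral (a + 1) b z := by
  have ha' : 0 < a + 1 := by linarith
  linear_combination mul_tricomiIntegral_add_one ha hb hz + mul_tricomiIntegral_add_one ha' hb hz
    - b * tricomiIntegral_add_tricomiIntegral ha' hb hz

/-- The Chebyshev correlation inequality for `t` and a positive power of `t`. -/
lemma tricomiIntegral_mul_lt {a a' b z : ℝ} (ha : 0 < a) (haa : a < a') (hb : 0 ≤ b) (hz : 0 < z) :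
    tricomiIntegral (a + 1) b z * tricomiIntegral a' b z
      < tricomiIntegral (a' + 1) b z * tricomiIntegral a b z := by
  have ha' : 0 < a' := by linarith
  have hJ := tricomiIntegral_pos ha hb hz
  have hK := tricomiIntegral_pos (a := a + 1) (by linarith) hb hz
  set J := tricomiIntegral a b z
  set K := tricomiIntegral (a + 1) b z
  -- `t₀` is where `t` attains its mean value `K / J`
  obtain ⟨t₀, ht₀, hKt⟩ : ∃ t₀, 0 < t₀ ∧ K = t₀ * J := ⟨K / J, by positivity, by field_simp⟩
  set q := t₀ ^ (a' - a)
  have i₁ := (integrableOn_tricomiKernel (a := a' + 1) (by linarith) hb hz)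
  have i₂ := (integrableOn_tricomiKernel (a := a') ha' hb hz)
  have i₃ := (integrableOn_tricomiKernel (a := a + 1) (by linarith) hb hz)
  have i₄ := (integrableOn_tricomiKernel (a := a) ha hb hz)
  have j₁ : IntegrableOn (fun t => tricomiKernel (a' + 1) b z t
      - t₀ * tricomiKernel a' b z t) (Ioi 0) := i₁.sub (i₂.const_mul t₀)
  have j₂ : IntegrableOn (fun t => q * (tricomiKernel (a + 1) b z t
      - t₀ * tricomiKernel a b z t)) (Ioi 0) := (i₃.sub (i₄.const_mul t₀)).const_mul q
  have hfac : ∀ t, 0 < t → tricomiKernel (a' + 1) b z t - t₀ * tricomiKernel a' b z t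
      - q * (tricomiKernel (a + 1) b z t - t₀ * tricomiKernel a b z t)
      = (t - t₀) * (t ^ (a' - a) - q) * tricomiKernel a b z t := by
    intro t ht
    have : tricomiKernel a' b z t = t ^ (a' - a) * tricomiKernel a b z t := by
      unfold tricomiKernel
      rw [show a' - 1 = (a' - a) + (a - 1) by ring, Real.rpow_add ht]; ring
    rw [tricomiKernel_add_one _ _ _ ht, tricomiKernel_add_one _ _ _ ht, this]; ring
  have hpos : ∀ t, 0 < t → t ≠ t₀ → 0 < (t - t₀) * (t ^ (a' - a) - q) := by
    intro t ht hne
    rcases hne.lt_or_gt with h | h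
    · exact mul_pos_of_neg_of_neg (by linarith)
        (sub_neg.2 (Real.rpow_lt_rpow ht.le h (by linarith)))
    · exact mul_pos (by linarith) (sub_pos.2 (Real.rpow_lt_rpow ht₀.le h (by linarith)))
  have key := setIntegral_Ioi_pos t₀ (f := fun t => tricomiKernel (a' + 1) b z t
      - t₀ * tricomiKernel a' b z t
      - q * (tricomiKernel (a + 1) b z t - t₀ * tricomiKernel a b z t))
    (fun t ht => by
      rw [hfac t ht]
      rcases eq_or_ne t t₀ with rfl | hne
      · simp
      · exact (mul_pos (hpos t ht hne) (tricomiKernel_pos _ _ _ ht)).le)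
    (fun t ht hne => by
      rw [hfac t ht]
      exact (mul_pos (hpos t ht hne) (tricomiKernel_pos _ _ _ ht)).ne') (j₁.sub j₂)
  rw [integral_sub j₁ j₂, integral_const_mul, integral_sub i₁ (i₂.const_mul t₀),
    integral_sub i₃ (i₄.const_mul t₀), integral_const_mul, integral_const_mul] at key
  change 0 < tricomiIntegral (a' + 1) b z - t₀ * tricomiIntegral a' b z
    - q * (K - t₀ * J) at key
  rw [hKt, sub_self, mul_zero, sub_zero] at key
  rw [hKt]
  nlinarith [mul_pos key hJ]

/-- The mean of `t` with respect to the density `tricomiKernel a b z`. -/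
noncomputable def tricomiMean (a b z : ℝ) : ℝ :=
  tricomiIntegral (a + 1) b z / tricomiIntegral a b z

lemma tricomiMean_pos {a b z : ℝ} (ha : 0 < a) (hb : 0 ≤ b) (hz : 0 < z) :
    0 < tricomiMean a b z :=
  div_pos (tricomiIntegral_pos (by linarith) hb hz) (tricomiIntegral_pos ha hb hz)

lemma mul_tricomiMean_le {a b z : ℝ} (ha : 0 < a) (hb : 0 ≤ b) (hz : 0 < z) :
    z * tricomiMean a b z ≤ a := by
  unfold tricomiMean
  rw [← mul_div_assoc, div_le_iff₀ (tricomiIntegral_pos ha hb hz),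
    mul_tricomiIntegral_add_one ha hb hz]
  nlinarith [tricomiIntegral_pos (a := a + 1) (b := b + 1) (z := z) (by linarith) (by linarith) hz]

lemma mul_tricomiMean_sub_lt {a a' b z : ℝ} (ha : 0 < a) (haa : a < a') (hb : 0 < b)
    (hz : 0 < z) : z * (tricomiMean a' b z - tricomiMean a b z) < a' - a := by
  have ha' : 0 < a' := by linarith
  have h : tricomiIntegral (a + 1) (b + 1) z * tricomiIntegral a' b z
      < tricomiIntegral (a' + 1) (b + 1) z * tricomiIntegral a b z := by
    rw [← tricomiIntegral_add_tricomiIntegral ha hb.le hz,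
      ← tricomiIntegral_add_tricomiIntegral ha' hb.le hz]
    linarith [tricomiIntegral_mul_lt ha haa (by linarith : 0 ≤ b + 1) hz]
  have hI := tricomiIntegral_pos ha hb.le hz
  have hI' := tricomiIntegral_pos ha' hb.le hz
  have e : ∀ {x}, 0 < x → z * tricomiMean x b z
      = x - b * (tricomiIntegral (x + 1) (b + 1) z / tricomiIntegral x b z) := by
    intro x hx
    have := tricomiIntegral_pos hx hb.le hz
    unfold tricomiMean
    rw [← mul_div_assoc, mul_tricomiIntegral_add_one hx hb.le hz]
    field_simp
  rw [mul_sub, e ha, e ha']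
  have := (div_lt_div_iff₀ hI hI').2 h
  nlinarith

lemma tricomiMean_lt {a a' b z : ℝ} (ha : 0 < a) (haa : a < a') (hb : 0 ≤ b) (hz : 0 < z) :
    tricomiMean a b z < tricomiMean a' b z :=
  (div_lt_div_iff₀ (tricomiIntegral_pos ha hb hz) (tricomiIntegral_pos (ha.trans haa) hb hz)).2
    (tricomiIntegral_mul_lt ha haa hb hz)

lemma hasDerivAt_tricomiMean {a b z : ℝ} (ha : 0 < a) (hb : 0 ≤ b) (hz : 0 < z) :
    HasDerivAt (tricomiMean a b) (tricomiMean a b z ^ 2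
      + ((z + b - a - 1) * tricomiMean a b z - a) / z) z := by
  have hI := tricomiIntegral_pos ha hb hz
  refine ((hasDerivAt_tricomiIntegral (a := a + 1) (by linarith) hb hz).div
    (hasDerivAt_tricomiIntegral ha hb hz) hI.ne').congr_deriv ?_
  have h := mul_tricomiIntegral_add_two ha hb hz
  unfold tricomiMean
  field_simp
  linear_combination -tricomiIntegral a b z * h

lemma hasDerivAt_log_tricomiIntegral {a b z : ℝ} (ha : 0 < a) (hb : 0 ≤ b) (hz : 0 < z) :
    HasDerivAt (fun z => Real.log (tricomiIntegral a b z)) (-tricomiMean a b z) z :=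
  ((hasDerivAt_tricomiIntegral ha hb hz).log (tricomiIntegral_pos ha hb hz).ne').congr_deriv
    (neg_div _ _)

lemma antitoneOn_tricomiIntegral {a b : ℝ} (ha : 0 < a) (hb : 0 ≤ b) :
    AntitoneOn (tricomiIntegral a b) (Ioi 0) := by
  refine antitoneOn_of_deriv_nonpos (convex_Ioi 0)
    (fun z hz => (hasDerivAt_tricomiIntegral ha hb hz).continuousAt.continuousWithinAt)
    (fun z hz => ?_) fun z hz => ?_
  all_goals rw [interior_Ioi] at hz
  · exact (hasDerivAt_tricomiIntegral ha hb hz).differentiableAt.differentiableWithinAt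
  · rw [(hasDerivAt_tricomiIntegral ha hb hz).deriv]
    exact neg_nonpos.2 (tricomiIntegral_pos (by linarith) hb hz).le

lemma tendsto_tricomiMean_atTop {a b : ℝ} (ha : 0 < a) (hb : 0 ≤ b) :
    Tendsto (tricomiMean a b) atTop (𝓝 0) := by
  refine squeeze_zero' (eventually_gt_atTop 0 |>.mono fun z hz => (tricomiMean_pos ha hb hz).le)
    (eventually_gt_atTop 0 |>.mono fun z hz => ?_) (tendsto_const_nhds.div_atTop tendsto_id (a := a))
  rw [id, le_div_iff₀ hz, mul_comm]
  exact mul_tricomiMean_le ha hb hz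

lemma strictAntiOn_Ioi_of_hasDerivAt_neg {f f' : ℝ → ℝ}
    (hf : ∀ z, 0 < z → HasDerivAt f (f' z) z) (hf' : ∀ z, 0 < z → f' z < 0) :
    StrictAntiOn f (Ioi 0) := by
  refine strictAntiOn_of_deriv_neg (convex_Ioi 0)
    (fun z hz => (hf z hz).continuousAt.continuousWithinAt) fun z hz => ?_
  rw [interior_Ioi] at hz
  rw [(hf z hz).deriv]
  exact hf' z hz

lemma StrictAntiOn.lt_of_tendsto_atTop {f : ℝ → ℝ} {l : ℝ} (hf : StrictAntiOn f (Ioi 0))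
    (hl : Tendsto f atTop (𝓝 l)) {z : ℝ} (hz : 0 < z) : l < f z := by
  have hz' : 0 < z + 1 := by linarith
  refine lt_of_le_of_lt (le_of_tendsto hl ?_) (hf hz hz' (by linarith))
  filter_upwards [eventually_ge_atTop (z + 1)] with x hx
  exact hf.antitoneOn hz' (hz'.trans_le hx) hx

lemma StrictAntiOn.lt_of_tendsto_nhdsGT {f : ℝ → ℝ} {l : ℝ} (hf : StrictAntiOn f (Ioi 0))
    (hl : Tendsto f (𝓝[>] 0) (𝓝 l)) {z : ℝ} (hz : 0 < z) : f z < l := by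
  have hz' : 0 < z / 2 := by linarith
  refine lt_of_lt_of_le (hf hz' hz (by linarith)) (ge_of_tendsto hl ?_)
  filter_upwards [Ioo_mem_nhdsGT hz'] with x hx
  exact hf.antitoneOn hx.1 hz' hx.2.le

/-- Midpoint convexity of the mean in the parameter `a`. The defect `y` of convexity satisfies a
linear differential inequality `y' < q y`; multiplied by the integrating factor, it decreases
strictly to `0` at infinity. -/
lemma two_mul_tricomiMean_lt {a b δ : ℝ} (ha : 0 < a) (hδ : 0 < δ) (hb : 0 < b) {z : ℝ}
    (hz : 0 < z) : 2 * tricomiMean (a + δ) b z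
      < tricomiMean a b z + tricomiMean (a + 2 * δ) b z := by
  have ha₁ : 0 < a + δ := by linarith
  have ha₂ : 0 < a + 2 * δ := by linarith
  set y : ℝ → ℝ := fun z =>
    tricomiMean a b z + tricomiMean (a + 2 * δ) b z - 2 * tricomiMean (a + δ) b z with hy
  set L : ℝ → ℝ := fun z => (Real.log (tricomiIntegral a b z)
    + Real.log (tricomiIntegral (a + 2 * δ) b z)) / 2 + Real.log (tricomiIntegral (a + δ) b z)
    with hL
  set E : ℝ → ℝ := fun z => L z - z - (b - 1 - (a + δ)) * Real.log z with hE
  have hE' : ∀ z, 0 < z → HasDerivAt E (-((tricomiMean a b z + tricomiMean (a + 2 * δ) b z) / 2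
      + tricomiMean (a + δ) b z) - 1 - (b - 1 - (a + δ)) / z) z := by
    intro z hz
    refine (((((hasDerivAt_log_tricomiIntegral ha hb.le hz).add
      (hasDerivAt_log_tricomiIntegral ha₂ hb.le hz)).div_const 2).add
      (hasDerivAt_log_tricomiIntegral ha₁ hb.le hz)).sub (hasDerivAt_id z)).sub
      ((Real.hasDerivAt_log hz.ne').const_mul (b - 1 - (a + δ))) |>.congr_deriv ?_
    ring
  have hy' : ∀ z, 0 < z → HasDerivAt y _ z := fun z hz =>
    ((hasDerivAt_tricomiMean ha hb.le hz).add (hasDerivAt_tricomiMean ha₂ hb.le hz)).sub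
      ((hasDerivAt_tricomiMean ha₁ hb.le hz).const_mul 2)
  have hanti : StrictAntiOn (fun z => y z * Real.exp (E z)) (Ioi 0) := by
    refine strictAntiOn_Ioi_of_hasDerivAt_neg (fun z hz => (hy' z hz).mul (hE' z hz).exp)
      fun z hz => ?_
    have hd := tricomiMean_lt ha (by linarith : a < a + 2 * δ) hb.le hz
    have hd' := mul_tricomiMean_sub_lt ha (by linarith : a < a + 2 * δ) hb hz
    have hexp := Real.exp_pos (E z)
    simp only [hy]
    generalize tricomiMean a b z = h₀ at *
    generalize tricomiMean (a + δ) b z = h₁ at *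
    generalize tricomiMean (a + 2 * δ) b z = h₂ at *
    generalize Real.exp (E z) = e at *
    have : 0 < (h₂ - h₀) * (2 * δ - z * (h₂ - h₀)) / (2 * z) * e :=
      mul_pos (div_pos (mul_pos (by linarith) (by linarith)) (by linarith)) hexp
    refine lt_of_eq_of_lt ?_ (neg_neg_of_pos this)
    field_simp
    ring
  have hlim : Tendsto (fun z => y z * Real.exp (E z)) atTop (𝓝 0) := by
    have hy0 : Tendsto y atTop (𝓝 0) := by
      simpa using ((tendsto_tricomiMean_atTop ha hb.le).add
        (tendsto_tricomiMean_atTop ha₂ hb.le)).sub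
        ((tendsto_tricomiMean_atTop ha₁ hb.le).const_mul 2)
    have hE0 : Tendsto (fun z => Real.exp (E z)) atTop (𝓝 0) := by
      have hT := (tendsto_rpow_mul_exp_neg_mul_atTop_nhds_zero
        (-(b - 1 - (a + δ))) 1 one_pos).const_mul (Real.exp (L 1))
      rw [mul_zero] at hT
      refine squeeze_zero' (Eventually.of_forall fun z => (Real.exp_pos _).le)
        ((eventually_ge_atTop 1).mono fun z hz => ?_) hT
      have hz0 : 0 < z := by linarith
      have hLz : L z ≤ L 1 := by
        have hlog : ∀ {x}, 0 < x →
            Real.log (tricomiIntegral x b z) ≤ Real.log (tricomiIntegral x b 1) := fun hx =>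
          Real.log_le_log (tricomiIntegral_pos hx hb.le hz0)
            (antitoneOn_tricomiIntegral hx hb.le (mem_Ioi.2 one_pos) hz0 hz)
        simp only [hL]
        linarith [hlog ha, hlog ha₁, hlog ha₂]
      rw [Real.rpow_def_of_pos hz0, ← Real.exp_add, ← Real.exp_add, Real.exp_le_exp]
      simp only [hE]
      linarith
    simpa using hy0.mul hE0
  have h := hanti.lt_of_tendsto_atTop hlim hz
  have := pos_of_mul_pos_left h (Real.exp_pos _).le
  simp only [hy] at this
  linarith

/-- The Turán quotient of the normalised Tricomi integrals. -/
noncomputable def tricomiTuranRatio (a δ b z : ℝ) : ℝ :=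
  (tricomiIntegral a b z / Real.Gamma a)
    * (tricomiIntegral (a + 2 * δ) b z / Real.Gamma (a + 2 * δ))
    / (tricomiIntegral (a + δ) b z / Real.Gamma (a + δ)) ^ 2

lemma strictAntiOn_tricomiTuranRatio {a b δ : ℝ} (ha : 0 < a) (hδ : 0 < δ) (hb : 0 < b) :
    StrictAntiOn (tricomiTuranRatio a δ b) (Ioi 0) := by
  have ha₁ : 0 < a + δ := by linarith
  have ha₂ : 0 < a + 2 * δ := by linarith
  have hlog : StrictAntiOn (fun z => Real.log (tricomiIntegral a b z)
      + Real.log (tricomiIntegral (a + 2 * δ) b z)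
      - 2 * Real.log (tricomiIntegral (a + δ) b z)) (Ioi 0) :=
    strictAntiOn_Ioi_of_hasDerivAt_neg
      (fun z hz => ((hasDerivAt_log_tricomiIntegral ha hb.le hz).add
        (hasDerivAt_log_tricomiIntegral ha₂ hb.le hz)).sub
        ((hasDerivAt_log_tricomiIntegral ha₁ hb.le hz).const_mul 2))
      fun z hz => by linarith [two_mul_tricomiMean_lt ha hδ hb hz]
  have hG := Real.Gamma_pos_of_pos ha
  have hG₁ := Real.Gamma_pos_of_pos ha₁
  have hG₂ := Real.Gamma_pos_of_pos ha₂
  have e : ∀ z, 0 < z → tricomiTuranRatio a δ b z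
      = Real.Gamma (a + δ) ^ 2 / (Real.Gamma a * Real.Gamma (a + 2 * δ))
        * Real.exp (Real.log (tricomiIntegral a b z)
      + Real.log (tricomiIntegral (a + 2 * δ) b z)
      - 2 * Real.log (tricomiIntegral (a + δ) b z)) := by
    intro z hz
    have h := tricomiIntegral_pos ha hb.le hz
    have h₁ := tricomiIntegral_pos ha₁ hb.le hz
    have h₂ := tricomiIntegral_pos ha₂ hb.le hz
    rw [Real.exp_sub, Real.exp_add, two_mul (Real.log _), Real.exp_add, Real.exp_log h,
      Real.exp_log h₁, Real.exp_log h₂]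
    unfold tricomiTuranRatio
    field_simp
  intro z hz w hw hzw
  rw [e z hz, e w hw]
  have := hlog hz hw hzw
  simp only at this
  gcongr

lemma tendsto_rpow_mul_tricomiIntegral_atTop {a b : ℝ} (ha : 0 < a) (hb : 0 ≤ b) :
    Tendsto (fun z => z ^ a * (tricomiIntegral a b z / Real.Gamma a)) atTop (𝓝 1) := by
  have hG := Real.Gamma_pos_of_pos ha
  have hlow : Tendsto (fun z : ℝ => (1 / (1 + b / z)) ^ a) atTop (𝓝 1) := by
    have h : Tendsto (fun z : ℝ => 1 / (1 + b / z)) atTop (𝓝 (1 / (1 + 0))) :=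
      tendsto_const_nhds.div (tendsto_const_nhds.add (tendsto_const_nhds.div_atTop tendsto_id))
        (by norm_num)
    simpa using h.rpow_const (p := a) (Or.inl (by norm_num))
  refine tendsto_of_tendsto_of_tendsto_of_le_of_le' hlow tendsto_const_nhds ?_ ?_
  · filter_upwards [eventually_gt_atTop 0] with z hz
    rw [show 1 / (1 + b / z) = z * (1 / (z + b)) by field_simp, Real.mul_rpow hz.le (by positivity)]
    gcongr
    exact (le_div_iff₀ hG).2 (le_tricomiIntegral ha hb hz)
  · filter_upwards [eventually_gt_atTop 0] with z hz
    calc z ^ a * (tricomiIntegral a b z / Real.Gamma a) ≤ z ^ a * (1 / z) ^ a := by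
          gcongr
          exact (div_le_iff₀ hG).2 (tricomiIntegral_le ha hb hz)
      _ = 1 := by
          rw [← Real.mul_rpow hz.le (by positivity), mul_one_div_cancel hz.ne', Real.one_rpow]

lemma tendsto_tricomiTuranRatio_atTop {a b δ : ℝ} (ha : 0 < a) (hδ : 0 < δ) (hb : 0 ≤ b) :
    Tendsto (tricomiTuranRatio a δ b) atTop (𝓝 1) := by
  have h := ((tendsto_rpow_mul_tricomiIntegral_atTop ha hb).mul
    (tendsto_rpow_mul_tricomiIntegral_atTop (by linarith : 0 < a + 2 * δ) hb)).div
    ((tendsto_rpow_mul_tricomiIntegral_atTop (by linarith : 0 < a + δ) hb).pow 2) (by norm_num)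
  simp only [mul_one, one_pow, div_one] at h
  refine h.congr' ?_
  filter_upwards [eventually_gt_atTop 0] with z hz
  have : z ^ a * z ^ (a + 2 * δ) = (z ^ (a + δ)) ^ 2 := by
    rw [sq, ← Real.rpow_add hz, ← Real.rpow_add hz]; ring_nf
  have h0 : (z ^ (a + δ)) ^ 2 ≠ 0 := by positivity
  simp only [Pi.div_apply]
  rw [mul_mul_mul_comm, this, mul_pow, mul_div_mul_left _ _ h0, tricomiTuranRatio]

/-- Euler's beta integral over the half-line, in extended nonnegative form. -/
lemma lintegral_tricomiKernel_zero {a b : ℝ} (ha : 0 < a) (hab : a < b) :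
    ∫⁻ t in Ioi (0 : ℝ), ENNReal.ofReal (tricomiKernel a b 0 t)
      = ENNReal.ofReal (Real.Gamma a * Real.Gamma (b - a) / Real.Gamma b) := by
  have hb : 0 < b := ha.trans hab
  have hG := Real.Gamma_pos_of_pos hb
  have hgamma : ∀ {p r : ℝ}, 0 < p → 0 < r →
      ∫⁻ u in Ioi (0 : ℝ), ENNReal.ofReal (u ^ (p - 1) * Real.exp (-(r * u)))
        = ENNReal.ofReal ((1 / r) ^ p * Real.Gamma p) := by
    intro p r hp hr
    rw [← Real.integral_rpow_mul_exp_neg_mul_Ioi hp hr,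
      ofReal_integral_eq_lintegral_ofReal (integrableOn_rpow_mul_exp_neg_mul hp hr)]
    filter_upwards [ae_restrict_mem measurableSet_Ioi] with u hu
    have hu : 0 < u := hu
    simp only [Pi.zero_apply]
    positivity
  have hinner : ∀ t, 0 < t → ENNReal.ofReal (tricomiKernel a b 0 t)
      = ∫⁻ u in Ioi (0 : ℝ), ENNReal.ofReal (1 / Real.Gamma b * t ^ (a - 1))
        * ENNReal.ofReal (u ^ (b - 1) * Real.exp (-((1 + t) * u))) := by
    intro t ht
    rw [lintegral_const_mul _ (by fun_prop), hgamma hb (by linarith),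
      ← ENNReal.ofReal_mul (by positivity)]
    congr 1
    unfold tricomiKernel
    rw [one_div (1 + t), Real.inv_rpow (by linarith), ← Real.rpow_neg (by linarith)]
    field_simp
    simp
  have houter : ∀ u, 0 < u → ∫⁻ t in Ioi (0 : ℝ), ENNReal.ofReal (1 / Real.Gamma b * t ^ (a - 1))
        * ENNReal.ofReal (u ^ (b - 1) * Real.exp (-((1 + t) * u)))
      = ENNReal.ofReal (Real.Gamma a / Real.Gamma b)
        * ENNReal.ofReal (u ^ (b - a - 1) * Real.exp (-(1 * u))) := by
    intro u hu
    have : ∀ t ∈ Ioi (0 : ℝ), ENNReal.ofReal (1 / Real.Gamma b * t ^ (a - 1))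
        * ENNReal.ofReal (u ^ (b - 1) * Real.exp (-((1 + t) * u)))
        = ENNReal.ofReal (1 / Real.Gamma b * (u ^ (b - 1) * Real.exp (-(1 * u))))
          * ENNReal.ofReal (t ^ (a - 1) * Real.exp (-(u * t))) := by
      intro t ht
      have ht : 0 < t := ht
      rw [← ENNReal.ofReal_mul (by positivity), ← ENNReal.ofReal_mul (by positivity),
        show -((1 + t) * u) = -(1 * u) + -(u * t) by ring, Real.exp_add]
      ring_nf
    rw [setLIntegral_congr_fun measurableSet_Ioi this, lintegral_const_mul _ (by fun_prop),
      hgamma ha hu, ← ENNReal.ofReal_mul (by positivity),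
      ← ENNReal.ofReal_mul (div_nonneg (Real.Gamma_pos_of_pos ha).le hG.le)]
    congr 1
    rw [one_div u, Real.inv_rpow hu.le, ← Real.rpow_neg hu.le,
      show b - a - 1 = (b - 1) + -a by ring, Real.rpow_add hu]
    ring
  rw [setLIntegral_congr_fun measurableSet_Ioi hinner, lintegral_lintegral_swap (by fun_prop),
    setLIntegral_congr_fun measurableSet_Ioi houter, lintegral_const_mul _ (by fun_prop),
    hgamma (by linarith) one_pos,
    ← ENNReal.ofReal_mul (div_nonneg (Real.Gamma_pos_of_pos ha).le hG.le)]
  congr 1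
  simp
  ring

lemma integrableOn_tricomiKernel_zero {a b : ℝ} (ha : 0 < a) (hab : a < b) :
    IntegrableOn (tricomiKernel a b 0) (Ioi 0) := by
  refine ⟨(measurable_tricomiKernel a b 0).aestronglyMeasurable, ?_⟩
  rw [hasFiniteIntegral_iff_ofReal, lintegral_tricomiKernel_zero ha hab]
  · exact ENNReal.ofReal_lt_top
  · filter_upwards [ae_restrict_mem measurableSet_Ioi] with t ht
      using (tricomiKernel_pos a b 0 ht).le

lemma tricomiIntegral_zero {a b : ℝ} (ha : 0 < a) (hab : a < b) :
    tricomiIntegral a b 0 = Real.Gamma a * Real.Gamma (b - a) / Real.Gamma b := by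
  have hG := Real.Gamma_pos_of_pos ha
  have hG₁ := Real.Gamma_pos_of_pos (sub_pos.2 hab)
  have hG₂ := Real.Gamma_pos_of_pos (ha.trans hab)
  unfold tricomiIntegral
  rw [integral_eq_lintegral_of_nonneg_ae _ (measurable_tricomiKernel a b 0).aestronglyMeasurable,
    lintegral_tricomiKernel_zero ha hab, ENNReal.toReal_ofReal (by positivity)]
  filter_upwards [ae_restrict_mem measurableSet_Ioi] with t ht using (tricomiKernel_pos a b 0 ht).le

lemma tendsto_tricomiIntegral_nhdsGT_zero {a b : ℝ} (ha : 0 < a) (hab : a < b) :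
    Tendsto (fun z => tricomiIntegral a b z / Real.Gamma a) (𝓝[>] 0)
      (𝓝 (Real.Gamma (b - a) / Real.Gamma b)) := by
  have hG := Real.Gamma_pos_of_pos ha
  have h : Tendsto (tricomiIntegral a b) (𝓝[>] 0) (𝓝 (tricomiIntegral a b 0)) := by
    refine tendsto_integral_filter_of_dominated_convergence (tricomiKernel a b 0)
      (Eventually.of_forall fun z => (measurable_tricomiKernel a b z).aestronglyMeasurable)
      ?_ (integrableOn_tricomiKernel_zero ha hab) (ae_of_all _ fun t => ?_)
    · filter_upwards [self_mem_nhdsWithin] with z hz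
      filter_upwards [ae_restrict_mem measurableSet_Ioi] with t ht
      rw [Real.norm_of_nonneg (tricomiKernel_pos a b z ht).le]
      have ht : 0 < t := ht
      have hz : 0 < z := hz
      unfold tricomiKernel
      gcongr
    · have : Continuous fun z => tricomiKernel a b z t := by unfold tricomiKernel; fun_prop
      exact this.continuousAt.tendsto.mono_left nhdsWithin_le_nhds
  have h' := h.div_const (Real.Gamma a)
  rwa [tricomiIntegral_zero ha hab, mul_div_assoc, mul_div_cancel_left₀ _ hG.ne'] at h'

lemma tendsto_tricomiTuranRatio_nhdsGT_zero {a b δ : ℝ} (ha : 0 < a) (hδ : 0 < δ)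
    (hab : a + 2 * δ < b) :
    Tendsto (tricomiTuranRatio a δ b) (𝓝[>] 0)
      (𝓝 (Real.Gamma (b - (a + 2 * δ)) * Real.Gamma (b - a) / Real.Gamma (b - (a + δ)) ^ 2)) := by
  have hG := Real.Gamma_pos_of_pos (by linarith : 0 < b)
  have hG₁ := Real.Gamma_pos_of_pos (by linarith : 0 < b - (a + δ))
  have h := ((tendsto_tricomiIntegral_nhdsGT_zero ha (by linarith : a < b)).mul
    (tendsto_tricomiIntegral_nhdsGT_zero (by linarith) hab)).div
    ((tendsto_tricomiIntegral_nhdsGT_zero (by linarith : 0 < a + δ)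
      (by linarith : a + δ < b)).pow 2)
    (by positivity)
  have hval : Real.Gamma (b - a) / Real.Gamma b * (Real.Gamma (b - (a + 2 * δ)) / Real.Gamma b)
      / (Real.Gamma (b - (a + δ)) / Real.Gamma b) ^ 2
      = Real.Gamma (b - (a + 2 * δ)) * Real.Gamma (b - a) / Real.Gamma (b - (a + δ)) ^ 2 := by
    field_simp
  rwa [hval] at h

lemma Psi_eq_tricomiIntegral_div (a c z : ℝ) :
    Psi a c z = tricomiIntegral a (a + 1 - c) z / Real.Gamma a := by
  unfold Psi tricomiIntegral tricomiKernel
  rw [show -(a + 1 - c) = c - a - 1 by ring]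
  ring

/-- Corollary: fractional Turán inequality for the `Ψ` function. For `a, λ > 0` and
`c < 1`, the ratio `z ↦ Ψ(a,c−2λ,z)Ψ(a+2λ,c,z)/Ψ(a+λ,c−λ,z)²` is strictly decreasing
on `(0,∞)` with the sharp bounds `1` and `Γ(1−c)Γ(1−c+2λ)/Γ(1−c+λ)²`. -/
theorem Psi_Turan (a lam c : ℝ) (ha : 0 < a) (hlam : 0 < lam) (hc : c < 1) :
    StrictAntiOn (fun z => Psi a (c - 2 * lam) z * Psi (a + 2 * lam) c z
        / (Psi (a + lam) (c - lam) z) ^ 2) (Ioi (0 : ℝ)) ∧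
    ∀ z : ℝ, 0 < z →
      1 < Psi a (c - 2 * lam) z * Psi (a + 2 * lam) c z / (Psi (a + lam) (c - lam) z) ^ 2 ∧
      Psi a (c - 2 * lam) z * Psi (a + 2 * lam) c z / (Psi (a + lam) (c - lam) z) ^ 2
        < Real.Gamma (1 - c) * Real.Gamma (1 - c + 2 * lam) / Real.Gamma (1 - c + lam) ^ 2 := by
  have hratio : ∀ z, Psi a (c - 2 * lam) z * Psi (a + 2 * lam) c z / (Psi (a + lam) (c - lam) z) ^ 2
      = tricomiTuranRatio a lam (a + 2 * lam + 1 - c) z := by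
    intro z
    simp only [Psi_eq_tricomiIntegral_div, tricomiTuranRatio]
    ring_nf
  simp only [hratio]
  have hanti := strictAntiOn_tricomiTuranRatio (b := a + 2 * lam + 1 - c) ha hlam (by linarith)
  have hzero := tendsto_tricomiTuranRatio_nhdsGT_zero (b := a + 2 * lam + 1 - c) ha hlam
    (by linarith)
  rw [show a + 2 * lam + 1 - c - (a + 2 * lam) = 1 - c by ring,
    show a + 2 * lam + 1 - c - a = 1 - c + 2 * lam by ring,
    show a + 2 * lam + 1 - c - (a + lam) = 1 - c + lam by ring] at hzero
  exact ⟨hanti, fun z hz => ⟨hanti.lt_of_tendsto_atTop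
    (tendsto_tricomiTuranRatio_atTop ha hlam (by linarith)) hz,
    hanti.lt_of_tendsto_nhdsGT hzero hz⟩⟩
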